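/- Assume q ≥ m. Then Ĥ(Q) = { lub({β^1, ..., β^m}) : β^1, ..., β^m ∈ Γ̂(Q) }; that is, the generalized Weierstrass semigroup at Q consists exactly of the least upper bounds of m-tuples of absolute maximal elements. -/

import Mathlib

open scoped Classical

/-- Abstract divisor-theoretic data of a nonsingular, projective, geometrically
irreducible algebraic curve over a field `Fq`: a function field `K`, a set of
closed points with their degrees, a genus, and the normalized discrete
valuations of `K` at the closed points (with the junk convention `v P 0 = 0`). -/
structure Curve (Fq : Type) [Field Fq] where
  /-- the function field of the curve -/
  K : Type
  [fieldK : Field K]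
  [algebraK : Algebra Fq K]
  /-- the closed points of the curve -/
  Point : Type
  /-- the degree of a closed point -/
  deg : Point → ℕ
  deg_pos : ∀ P, 0 < deg P
  /-- the genus of the curve -/
  genus : ℕ
  /-- the normalized discrete valuation at a closed point -/
  v : Point → K → ℤ
  v_zero : ∀ P, v P 0 = 0
  v_mul : ∀ (P : Point) {x y : K}, x ≠ 0 → y ≠ 0 → v P (x * y) = v P x + v P y
  v_min_le_add : ∀ (P : Point) {x y : K}, x ≠ 0 → y ≠ 0 → x + y ≠ 0 →
    min (v P x) (v P y) ≤ v P (x + y)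
  v_algebraMap : ∀ (P : Point) (c : Fq), c ≠ 0 → v P (algebraMap Fq K c) = 0
  v_surjective : ∀ P : Point, ∃ x : K, x ≠ 0 ∧ v P x = 1
  /-- a nonzero function has only finitely many zeros and poles -/
  support_finite : ∀ {x : K}, x ≠ 0 → {P : Point | v P x ≠ 0}.Finite
  /-- a function without poles is constant (the curve is projective and
  geometrically irreducible) -/
  no_pole_constant : ∀ {x : K}, x ≠ 0 → (∀ P, 0 ≤ v P x) → ∃ c : Fq, x = algebraMap Fq K c
  /-- principal divisors have degree zero -/
  degree_principal : ∀ {x : K}, x ≠ 0 → ∑ᶠ P : Point, (deg P : ℤ) * v P x = 0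

attribute [instance] Curve.fieldK Curve.algebraK

namespace Curve

variable {Fq : Type} [Field Fq] [Fintype Fq]

/-- The degree of a divisor. -/
noncomputable def degDiv (C : Curve Fq) (D : C.Point →₀ ℤ) : ℤ :=
  D.sum fun P n => (C.deg P : ℤ) * n

/-- The Riemann–Roch space `L(D)`. -/
def Lset (C : Curve Fq) (D : C.Point →₀ ℤ) : Set C.K :=
  {h | h = 0 ∨ ∀ P : C.Point, 0 ≤ C.v P h + D P}

/-- `ℓ(D)`, the dimension of `L(D)` as an `Fq`-vector space. -/
noncomputable def ell (C : Curve Fq) (D : C.Point →₀ ℤ) : ℕ :=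
  Module.finrank Fq (Submodule.span Fq (C.Lset D))

/-- The divisor `D` is principal. -/
def IsPrincipalDiv (C : Curve Fq) (D : C.Point →₀ ℤ) : Prop :=
  ∃ h : C.K, h ≠ 0 ∧ ∀ P : C.Point, C.v P h = D P

/-- The divisor `D_α = α₁Q₁ + ⋯ + α_mQ_m`. -/
noncomputable def Dt (C : Curve Fq) {m : ℕ} (Q : Fin m → C.Point) (α : Fin m → ℤ) :
    C.Point →₀ ℤ :=
  ∑ i, Finsupp.single (Q i) (α i)

/-- The generalized Weierstrass semigroup `Ĥ(Q)`: the set of tuples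
`(-v_{Q_1}(h), …, -v_{Q_m}(h))` for nonzero `h` having poles only in `{Q_1, …, Q_m}`. -/
def Hhat (C : Curve Fq) {m : ℕ} (Q : Fin m → C.Point) : Set (Fin m → ℤ) :=
  {α | ∃ h : C.K, h ≠ 0 ∧ (∀ P : C.Point, P ∉ Set.range Q → 0 ≤ C.v P h) ∧
    ∀ i, α i = -C.v (Q i) h}

/-- `∇_J(α)`. -/
def nabla (C : Curve Fq) {m : ℕ} (Q : Fin m → C.Point) (J : Set (Fin m))
    (α : Fin m → ℤ) : Set (Fin m → ℤ) :=
  {β | β ∈ C.Hhat Q ∧ (∀ j ∈ J, β j = α j) ∧ ∀ i ∉ J, β i < α i}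

/-- `∇_i^m(α)`. -/
def nablaI (C : Curve Fq) {m : ℕ} (Q : Fin m → C.Point) (i : Fin m) (α : Fin m → ℤ) :
    Set (Fin m → ℤ) :=
  {β | β ∈ C.Hhat Q ∧ β i = α i ∧ ∀ j, j ≠ i → β j ≤ α j}

/-- `Γ̂(Q)`, the set of absolute maximal elements of `Ĥ(Q)`. -/
def Gammahat (C : Curve Fq) {m : ℕ} (Q : Fin m → C.Point) : Set (Fin m → ℤ) :=
  {α | α ∈ C.Hhat Q ∧
    ∀ J : Set (Fin m), J.Nonempty → J ≠ Set.univ → C.nabla Q J α = ∅}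

/-- `Γ̂_Q(α) = {β ∈ Γ̂(Q) : β ≤ α}`. -/
def GammahatLe (C : Curve Fq) {m : ℕ} (Q : Fin m → C.Point) (α : Fin m → ℤ) :
    Set (Fin m → ℤ) :=
  {β | β ∈ C.Gammahat Q ∧ ∀ i, β i ≤ α i}

/-- The divisor `A` is a discrepancy with respect to `P` and `Q'`. -/
def IsDiscrepancy (C : Curve Fq) (A : C.Point →₀ ℤ) (P Q' : C.Point) : Prop :=
  C.Lset A ≠ C.Lset (A - Finsupp.single Q' 1) ∧
  C.Lset (A - Finsupp.single P 1) = C.Lset (A - Finsupp.single P 1 - Finsupp.single Q' 1)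

/-- `T_α = {β ∈ ℤ^m : β ≤ α and ℓ(D_β) = ℓ(D_α)}`. -/
def Tset (C : Curve Fq) {m : ℕ} (Q : Fin m → C.Point) (α : Fin m → ℤ) :
    Set (Fin m → ℤ) :=
  {β | (∀ j, β j ≤ α j) ∧ C.ell (C.Dt Q β) = C.ell (C.Dt Q α)}

/-- `D_β` is the supported floor `⌊D_α⌋_Q`: `β` is the element of `T_α` of minimum
norm `|β| = β₁ + ⋯ + β_m`. -/
def IsSuppFloor (C : Curve Fq) {m : ℕ} (Q : Fin m → C.Point) (α β : Fin m → ℤ) : Prop :=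
  β ∈ C.Tset Q α ∧ ∀ γ ∈ C.Tset Q α, ∑ i, β i ≤ ∑ i, γ i

/-- `G'` is the floor `⌊G⌋` of `G`: among all divisors with the same Riemann–Roch
space as `G`, it has minimum degree. -/
def IsFloorDiv (C : Curve Fq) (G G' : C.Point →₀ ℤ) : Prop :=
  C.Lset G' = C.Lset G ∧
  ∀ G'' : C.Point →₀ ℤ, C.Lset G'' = C.Lset G → C.degDiv G' ≤ C.degDiv G''

end Curve

namespace Curve

variable {Fq : Type} [Field Fq] (C : Curve Fq)

/-- The functions of valuation at least `n` at `P`, together with zero. -/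
def valGE (P : C.Point) (n : ℤ) : Submodule Fq C.K where
  carrier := {h | h = 0 ∨ n ≤ C.v P h}
  zero_mem' := Or.inl rfl
  add_mem' := by
    intro x y hx hy
    by_cases hx0 : x = 0
    · simpa [hx0] using hy
    by_cases hy0 : y = 0
    · simpa [hy0] using hx
    by_cases hxy : x + y = 0
    · exact Or.inl hxy
    · exact Or.inr <| (le_min (hx.resolve_left hx0) (hy.resolve_left hy0)).trans
        (C.v_min_le_add P hx0 hy0 hxy)
  smul_mem' := by
    intro c x hx
    by_cases hc : c = 0
    · exact Or.inl (by simp [hc])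
    by_cases hx0 : x = 0
    · exact Or.inl (by simp [hx0])
    right
    have hc' : algebraMap Fq C.K c ≠ 0 := by simpa using hc
    rw [Algebra.smul_def, C.v_mul P hc' hx0, C.v_algebraMap P c hc, zero_add]
    exact hx.resolve_left hx0

variable {C}

theorem mem_valGE {P : C.Point} {n : ℤ} {h : C.K} :
    h ∈ C.valGE P n ↔ h = 0 ∨ n ≤ C.v P h := Iff.rfl

theorem valGE_antitone (P : C.Point) : Antitone (C.valGE P) :=
  fun _ _ hab _ hx => hx.imp_right hab.trans

theorem mem_valGE_and_notMem_iff {P : C.Point} {n : ℤ} {h : C.K} :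
    (h ∈ C.valGE P n ∧ h ∉ C.valGE P (n + 1)) ↔ h ≠ 0 ∧ C.v P h = n := by
  simp only [mem_valGE]
  by_cases h0 : h = 0
  · simp [h0]
  · simp only [h0, false_or, ne_eq, not_false_eq_true, true_and]
    omega

variable (C) in
/-- The Riemann–Roch space of `D` as a subspace. -/
def Lspace (D : C.Point →₀ ℤ) : Submodule Fq C.K := ⨅ P, C.valGE P (-D P)

theorem mem_Lspace {D : C.Point →₀ ℤ} {h : C.K} :
    h ∈ C.Lspace D ↔ ∀ P, h ∈ C.valGE P (-D P) := by
  simp [Lspace]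

theorem coe_Lspace (D : C.Point →₀ ℤ) : (C.Lspace D : Set C.K) = C.Lset D := by
  ext h
  simp only [SetLike.mem_coe, mem_Lspace, mem_valGE, Lset, Set.mem_ofPred_eq]
  by_cases h0 : h = 0
  · simp [h0]
  · simp only [h0, false_or]
    exact forall_congr' fun P => by omega

theorem Lspace_mono : Monotone C.Lspace := fun _ _ hDE _ hx =>
  mem_Lspace.2 fun P => valGE_antitone P (neg_le_neg (hDE P)) (mem_Lspace.1 hx P)

/-- The divisor of a nonzero function. -/
noncomputable def divisor {h : C.K} (h0 : h ≠ 0) : C.Point →₀ ℤ :=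
  Finsupp.ofSupportFinite (fun P => C.v P h) (C.support_finite h0)

theorem divisor_apply {h : C.K} (h0 : h ≠ 0) (P : C.Point) : divisor h0 P = C.v P h := rfl

theorem ell_eq_finrank (D : C.Point →₀ ℤ) : C.ell D = Module.finrank Fq (C.Lspace D) := by
  rw [ell, ← coe_Lspace, Submodule.span_eq]

theorem degDiv_add (D E : C.Point →₀ ℤ) : C.degDiv (D + E) = C.degDiv D + C.degDiv E :=
  Finsupp.sum_add_index' (by simp) (by intros; ring)

theorem degDiv_sub (D E : C.Point →₀ ℤ) : C.degDiv (D - E) = C.degDiv D - C.degDiv E := by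
  have := degDiv_add (D - E) E
  rw [sub_add_cancel] at this
  omega

theorem degDiv_single (P : C.Point) (n : ℤ) :
    C.degDiv (Finsupp.single P n) = C.deg P * n := by
  simp [degDiv]

theorem degDiv_nonneg {D : C.Point →₀ ℤ} (hD : 0 ≤ D) : 0 ≤ C.degDiv D :=
  Finset.sum_nonneg fun P _ => mul_nonneg (by positivity) (hD P)

theorem degDiv_divisor {h : C.K} (h0 : h ≠ 0) : C.degDiv (divisor h0) = 0 := by
  rw [← C.degree_principal h0, degDiv, Finsupp.sum]
  refine (finsum_eq_sum_of_support_subset _ fun P hP => ?_).symm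
  simp only [Function.mem_support] at hP
  simpa [divisor_apply] using right_ne_zero_of_mul hP

theorem degDiv_nonneg_of_mem_Lspace {D : C.Point →₀ ℤ} {h : C.K} (h0 : h ≠ 0)
    (hh : h ∈ C.Lspace D) : 0 ≤ C.degDiv D := by
  have key : 0 ≤ C.degDiv (divisor h0 + D) := by
    refine degDiv_nonneg fun P => ?_
    have := (mem_Lspace.1 hh P).resolve_left h0
    simp only [Finsupp.coe_zero, Pi.zero_apply, Finsupp.add_apply, divisor_apply]
    omega
  rwa [degDiv_add, degDiv_divisor, zero_add] at key

theorem Lspace_eq_bot {D : C.Point →₀ ℤ} (hD : C.degDiv D < 0) : C.Lspace D = ⊥ := by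
  refine (Submodule.eq_bot_iff _).2 fun h hh => ?_
  by_contra h0
  exact absurd (degDiv_nonneg_of_mem_Lspace h0 hh) (by omega)

variable {K₀ : C.Point →₀ ℤ}

theorem finiteDimensional_Lspace
    (hRR : ∀ D : C.Point →₀ ℤ, (C.ell D : ℤ) - C.ell (K₀ - D) = C.degDiv D + 1 - C.genus)
    (P : C.Point) (D : C.Point →₀ ℤ) : FiniteDimensional Fq (C.Lspace D) := by
  set n : ℤ := |C.degDiv D| + |C.degDiv K₀| + C.genus + 1 with hn
  have hn0 : 0 ≤ n := by positivity
  set E := D + Finsupp.single P n with hE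
  have hDE : D ≤ E := le_add_of_nonneg_right (by simpa using hn0)
  have hdeg : C.degDiv D + n ≤ C.degDiv E := by
    rw [hE, degDiv_add, degDiv_single]
    have : (1 : ℤ) ≤ C.deg P := by exact_mod_cast C.deg_pos P
    nlinarith
  have h1 := neg_abs_le (C.degDiv D)
  have h2 := le_abs_self (C.degDiv K₀)
  have h3 := abs_nonneg (C.degDiv K₀)
  have hbot : C.ell (K₀ - E) = 0 := by
    rw [ell_eq_finrank, Lspace_eq_bot, finrank_bot]
    rw [degDiv_sub]
    omega
  have hpos : 0 < Module.finrank Fq (C.Lspace E) := by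
    have := hRR E
    rw [hbot] at this
    rw [← ell_eq_finrank]
    omega
  have := FiniteDimensional.of_finrank_pos hpos
  exact Submodule.finiteDimensional_of_le (Lspace_mono hDE)

theorem ell_le_ell_sub_single_add_one
    (hRR : ∀ D : C.Point →₀ ℤ, (C.ell D : ℤ) - C.ell (K₀ - D) = C.degDiv D + 1 - C.genus)
    {P : C.Point} (hP : C.deg P = 1) (D : C.Point →₀ ℤ) :
    C.ell D ≤ C.ell (D - Finsupp.single P 1) + 1 := by
  have h1 := hRR D
  have h2 := hRR (D - Finsupp.single P 1)
  have hle : K₀ - D ≤ K₀ - (D - Finsupp.single P 1) :=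
    sub_le_sub_left (sub_le_self _ (by simp)) _
  have := finiteDimensional_Lspace hRR P (K₀ - (D - Finsupp.single P 1))
  have h3 : C.ell (K₀ - D) ≤ C.ell (K₀ - (D - Finsupp.single P 1)) := by
    simpa only [ell_eq_finrank] using Submodule.finrank_mono (Lspace_mono hle)
  rw [degDiv_sub, degDiv_single, hP] at h2
  push_cast at h2
  omega

/-- At a point of degree one, the leading terms of two functions of the same valuation
are proportional over the base field. -/
theorem exists_sub_smul_mem_valGE
    (hRR : ∀ D : C.Point →₀ ℤ, (C.ell D : ℤ) - C.ell (K₀ - D) = C.degDiv D + 1 - C.genus)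
    {P : C.Point} (hP : C.deg P = 1) {x y : C.K} (hx : x ≠ 0) (hy : y ≠ 0)
    (hxy : C.v P x = C.v P y) : ∃ c : Fq, x - c • y ∈ C.valGE P (C.v P x + 1) := by
  set D : C.Point →₀ ℤ := -(divisor hx ⊓ divisor hy) with hD
  have hDapp (R : C.Point) : -D R = min (C.v R x) (C.v R y) := by
    simp [hD, divisor_apply]
  have hDP : -(D - Finsupp.single P 1 : C.Point →₀ ℤ) P = C.v P x + 1 := by
    have := hDapp P
    rw [← hxy, min_self] at this
    rw [Finsupp.sub_apply, Finsupp.single_eq_same]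
    omega
  have hxD : x ∈ C.Lspace D := mem_Lspace.2 fun R => Or.inr (by rw [hDapp]; exact min_le_left _ _)
  have hyD : y ∈ C.Lspace D := mem_Lspace.2 fun R => Or.inr (by rw [hDapp]; exact min_le_right _ _)
  set W := C.Lspace (D - Finsupp.single P 1) with hW
  have hyW : y ∉ W := fun h => by
    have := (mem_Lspace.1 h P).resolve_left hy
    omega
  have hfin := finiteDimensional_Lspace hRR P D
  have hWD : W ≤ C.Lspace D := Lspace_mono (sub_le_self _ (by simp))
  have hsup : W ⊔ Submodule.span Fq {y} ≤ C.Lspace D :=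
    sup_le hWD ((Submodule.span_singleton_le_iff_mem _ _).2 hyD)
  have hlt : W < W ⊔ Submodule.span Fq {y} :=
    lt_of_le_of_ne le_sup_left fun h => hyW <| by
      rw [h]
      exact Submodule.mem_sup_right (Submodule.mem_span_singleton_self y)
  have := Submodule.finiteDimensional_of_le hsup
  have hrank := Submodule.finrank_lt_finrank_of_lt hlt
  have hell := ell_le_ell_sub_single_add_one hRR hP D
  rw [ell_eq_finrank, ell_eq_finrank, ← hW] at hell
  have heq := Submodule.eq_of_le_of_finrank_le hsup (by omega)
  rw [← heq] at hxD
  obtain ⟨w, hw, z, hz, rfl⟩ := Submodule.mem_sup.1 hxD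
  obtain ⟨c, rfl⟩ := Submodule.mem_span_singleton.1 hz
  refine ⟨c, ?_⟩
  rw [add_sub_cancel_right, ← hDP]
  exact mem_Lspace.1 hw P

variable {m : ℕ} {Q : Fin m → C.Point}

theorem mem_Hhat_iff (hm : 0 < m) {α : Fin m → ℤ} :
    α ∈ C.Hhat Q ↔ ∃ h : C.K, (∀ P ∉ Set.range Q, h ∈ C.valGE P 0) ∧
      ∀ i, h ∈ C.valGE (Q i) (-α i) ∧ h ∉ C.valGE (Q i) (-α i + 1) := by
  simp only [mem_valGE_and_notMem_iff]
  constructor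
  · rintro ⟨h, h0, hP, hQ⟩
    exact ⟨h, fun P hR => Or.inr (hP P hR), fun i => ⟨h0, by rw [hQ, neg_neg]⟩⟩
  · rintro ⟨h, hP, hQ⟩
    have h0 := (hQ ⟨0, hm⟩).1
    exact ⟨h, h0, fun P hR => (hP P hR).resolve_left h0, fun i => by rw [(hQ i).2, neg_neg]⟩

theorem sup_mem_Hhat [Fintype Fq] (hm : 0 < m) (hq : m ≤ Fintype.card Fq) {α β : Fin m → ℤ}
    (hα : α ∈ C.Hhat Q) (hβ : β ∈ C.Hhat Q) : α ⊔ β ∈ C.Hhat Q := by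
  by_cases hle : α ≤ β
  · rwa [sup_eq_right.2 hle]
  obtain ⟨i₀, hi₀⟩ : ∃ i, β i < α i := by simpa [Pi.le_def] using hle
  obtain ⟨x, hxP, hxQ⟩ := (mem_Hhat_iff hm).1 hα
  obtain ⟨y, hyP, hyQ⟩ := (mem_Hhat_iff hm).1 hβ
  let bad (i : Fin m) (c : Fq) : Prop := x + c • y ∈ C.valGE (Q i) (-(α ⊔ β) i + 1)
  have hbad_le {i c} (h : bad i c) : α i ≤ β i := by
    by_contra! hlt
    have hy : y ∈ C.valGE (Q i) (-α i + 1) := valGE_antitone _ (by omega) (hyQ i).1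
    have h' : x + c • y ∈ C.valGE (Q i) (-α i + 1) := by
      simpa [bad, Pi.sup_apply, sup_eq_left.2 hlt.le] using h
    exact (hxQ i).2 ((Submodule.add_mem_iff_left _ (Submodule.smul_mem _ c hy)).1 h')
  have hbad_unique {i c d} (hc : bad i c) (hd : bad i d) : c = d := by
    by_contra hcd
    have hsub : (c - d) • y ∈ C.valGE (Q i) (-(α ⊔ β) i + 1) := by
      have := Submodule.sub_mem _ hc hd
      rwa [add_sub_add_left_eq_sub, ← sub_smul] at this
    rw [Submodule.smul_mem_iff _ (sub_ne_zero.2 hcd), Pi.sup_apply,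
      sup_eq_right.2 (hbad_le hc)] at hsub
    exact (hyQ i).2 hsub
  obtain ⟨c, hc⟩ : ∃ c, ∀ i, ¬ bad i c := by
    by_contra! hall
    choose f hf using hall
    have hinj : Function.Injective f := fun c d h => hbad_unique (hf c) (h ▸ hf d)
    have hsurj : Function.Surjective f :=
      ((Fintype.bijective_iff_injective_and_card f).2
        ⟨hinj, le_antisymm (Fintype.card_le_of_injective f hinj) (by simpa using hq)⟩).2
    obtain ⟨c, rfl⟩ := hsurj i₀
    exact absurd (hbad_le (hf c)) (by omega)
  refine (mem_Hhat_iff hm).2 ⟨x + c • y, fun P hP =>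
    Submodule.add_mem _ (hxP P hP) (Submodule.smul_mem _ c (hyP P hP)), fun i => ⟨?_, hc i⟩⟩
  exact Submodule.add_mem _ (valGE_antitone _ (neg_le_neg le_sup_left) (hxQ i).1)
    (Submodule.smul_mem _ c (valGE_antitone _ (neg_le_neg le_sup_right) (hyQ i).1))

theorem Dt_apply (hQ : Function.Injective Q) (α : Fin m → ℤ) (i : Fin m) :
    C.Dt Q α (Q i) = α i := by
  simp [Dt, Finsupp.finsetSum_apply, Finsupp.single_apply, hQ.eq_iff]

theorem Dt_apply_of_notMem (α : Fin m → ℤ) {P : C.Point} (hP : P ∉ Set.range Q) :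
    C.Dt Q α P = 0 := by
  rw [Dt, Finsupp.finsetSum_apply]
  exact Finset.sum_eq_zero fun i _ =>
    Finsupp.single_eq_of_ne fun h => hP ⟨i, h.symm⟩

theorem degDiv_Dt (hQdeg : ∀ i, C.deg (Q i) = 1) (α : Fin m → ℤ) :
    C.degDiv (C.Dt Q α) = ∑ i, α i := by
  rw [Dt, ← AddMonoidHom.mk'_apply (M := C.Point →₀ ℤ) C.degDiv degDiv_add, map_sum]
  simp [degDiv_single, hQdeg]

theorem sum_nonneg_of_mem_Hhat (hQ : Function.Injective Q) (hQdeg : ∀ i, C.deg (Q i) = 1)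
    {α : Fin m → ℤ} (hα : α ∈ C.Hhat Q) : 0 ≤ ∑ i, α i := by
  obtain ⟨h, h0, hP, hα⟩ := hα
  rw [← degDiv_Dt hQdeg]
  refine degDiv_nonneg_of_mem_Lspace h0 (mem_Lspace.2 fun P => Or.inr ?_)
  by_cases hR : P ∈ Set.range Q
  · obtain ⟨i, rfl⟩ := hR
    rw [Dt_apply hQ, hα, neg_neg]
  · simpa [Dt_apply_of_notMem α hR] using hP P hR

/-- An element of `Ĥ(Q)` that is not absolute maximal can be decreased within `Ĥ(Q)` while
keeping any prescribed coordinate. -/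
theorem exists_lt_of_notMem_Gammahat
    (hRR : ∀ D : C.Point →₀ ℤ, (C.ell D : ℤ) - C.ell (K₀ - D) = C.degDiv D + 1 - C.genus)
    (hQdeg : ∀ i, C.deg (Q i) = 1) {α : Fin m → ℤ} (hα : α ∈ C.Hhat Q)
    (hαΓ : α ∉ C.Gammahat Q) (i : Fin m) : ∃ β ∈ C.Hhat Q, β < α ∧ β i = α i := by
  simp only [Gammahat, Set.mem_ofPred_eq, hα, true_and] at hαΓ
  push Not at hαΓ
  obtain ⟨J, ⟨j, hj⟩, hJ, β, hβ, hβJ, hβJ'⟩ := hαΓ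
  have hβα : β ≤ α := fun k => by
    by_cases hk : k ∈ J
    · exact (hβJ k hk).le
    · exact (hβJ' k hk).le
  by_cases hi : i ∈ J
  · obtain ⟨k, hk⟩ := (Set.ne_univ_iff_exists_notMem J).1 hJ
    exact ⟨β, hβ, Pi.lt_def.2 ⟨hβα, k, hβJ' k hk⟩, hβJ i hi⟩
  obtain ⟨x, hx0, hxP, hxQ⟩ := hα
  obtain ⟨y, hy0, hyP, hyQ⟩ := hβ
  obtain ⟨c, hc⟩ := exists_sub_smul_mem_valGE hRR (hQdeg j) hx0 hy0
    (by have := hβJ j hj; rw [hxQ, hyQ] at this; omega)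
  have hle (k : Fin m) : x - c • y ∈ C.valGE (Q k) (-α k) := by
    refine Submodule.sub_mem _ (Or.inr ?_) (Submodule.smul_mem _ c (Or.inr ?_))
    · rw [hxQ, neg_neg]
    · have := hβα k
      rw [hyQ] at this
      exact neg_le.1 this
  have hiv : x - c • y ∉ C.valGE (Q i) (-α i + 1) := fun h => by
    have hy : y ∈ C.valGE (Q i) (-α i + 1) := Or.inr <| by
      have := hβJ' i hi
      rw [hyQ] at this
      omega
    have hx := (Submodule.sub_mem_iff_left _ (Submodule.smul_mem _ c hy)).1 h
    have := hx.resolve_left hx0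
    rw [hxQ] at this
    omega
  obtain ⟨hz0, hzi⟩ := mem_valGE_and_notMem_iff.1 ⟨hle i, hiv⟩
  refine ⟨fun k => -C.v (Q k) (x - c • y), ⟨_, hz0, fun P hP => ?_, fun _ => rfl⟩, ?_, ?_⟩
  · have : x - c • y ∈ C.valGE P 0 :=
      Submodule.sub_mem _ (Or.inr (hxP P hP)) (Submodule.smul_mem _ c (Or.inr (hyP P hP)))
    exact this.resolve_left hz0
  · refine Pi.lt_def.2 ⟨fun k => ?_, j, ?_⟩
    · exact neg_le.1 ((hle k).resolve_left hz0)
    · have := hc.resolve_left hz0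
      rw [hxQ j]
      omega
  · simp only [hzi, neg_neg]

theorem exists_mem_Gammahat_le
    (hRR : ∀ D : C.Point →₀ ℤ, (C.ell D : ℤ) - C.ell (K₀ - D) = C.degDiv D + 1 - C.genus)
    (hQ : Function.Injective Q) (hQdeg : ∀ i, C.deg (Q i) = 1) {α : Fin m → ℤ}
    (hα : α ∈ C.Hhat Q) (i : Fin m) : ∃ β ∈ C.Gammahat Q, β ≤ α ∧ β i = α i := by
  induction hn : (∑ k, α k).toNat using Nat.strong_induction_on generalizing α with
  | _ n ih =>
    by_cases hαΓ : α ∈ C.Gammahat Q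
    · exact ⟨α, hαΓ, le_rfl, rfl⟩
    obtain ⟨β, hβ, hlt, hβi⟩ := exists_lt_of_notMem_Gammahat hRR hQdeg hα hαΓ i
    have hsum : ∑ k, β k < ∑ k, α k := by
      obtain ⟨hle, k, hk⟩ := Pi.lt_def.1 hlt
      exact Finset.sum_lt_sum (fun k _ => hle k) ⟨k, Finset.mem_univ k, hk⟩
    have h0 := sum_nonneg_of_mem_Hhat hQ hQdeg hβ
    obtain ⟨γ, hγ, hγle, hγi⟩ := ih _ (by omega) hβ rfl
    exact ⟨γ, hγ, hγle.trans hlt.le, hγi.trans hβi⟩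

end Curve

/-- Theorem 2.4: assume `q ≥ m`.  The generalized Weierstrass
semigroup `Ĥ(Q)` consists exactly of the least upper bounds of `m`-tuples of
absolute maximal elements. -/
theorem statement18 {Fq : Type} [Field Fq] [Fintype Fq] (C : Curve Fq)
    (hgenus : 0 < C.genus) (K₀ : C.Point →₀ ℤ)
    (hRR : ∀ D : C.Point →₀ ℤ,
      (C.ell D : ℤ) - C.ell (K₀ - D) = C.degDiv D + 1 - C.genus)
    {m : ℕ} (hm : 2 ≤ m) (Q : Fin m → C.Point)
    (hQinj : Function.Injective Q) (hQdeg : ∀ i, C.deg (Q i) = 1)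
    (hq : m ≤ Fintype.card Fq) :
    C.Hhat Q = {γ : Fin m → ℤ | ∃ β : Fin m → (Fin m → ℤ),
      (∀ k, β k ∈ C.Gammahat Q) ∧
      ∀ i, γ i = sSup (Set.range fun k => β k i)} := by
  have hm0 : 0 < m := by omega
  have : Nonempty (Fin m) := ⟨⟨0, hm0⟩⟩
  ext γ
  constructor
  · intro hγ
    choose β hβ hle hβi using fun i => Curve.exists_mem_Gammahat_le hRR hQinj hQdeg hγ i
    refine ⟨β, hβ, fun i => ?_⟩
    have hmax : IsGreatest (Set.range fun k => β k i) (γ i) := by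
      refine ⟨⟨i, hβi i⟩, ?_⟩
      rintro _ ⟨k, rfl⟩
      exact hle k i
    exact hmax.csSup_eq.symm
  · rintro ⟨β, hβ, hγ⟩
    have hsup : Finset.univ.sup' Finset.univ_nonempty β ∈ C.Hhat Q :=
      Finset.sup'_induction _ _ (fun _ hx _ hy => Curve.sup_mem_Hhat hm0 hq hx hy)
        fun k _ => (hβ k).1
    convert hsup using 1
    ext i
    rw [hγ, Finset.sup'_apply, Finset.sup'_univ_eq_ciSup, iSup]
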